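/- arXiv:2602.13097 — 3 statements merged into one kernel-verified Lean document; each statement's English description precedes it below -/
import Mathlib

section
/- Let G be a finite group and π : G → B a partial representation on a unital associative k-algebra B. Then for every g ∈ G, ε_g equals the sum of P_X over all subsets X ⊆ G with e ∈ X and g ∈ X. -/
open scoped Pointwise

/-- A partial representation of a group `G` on a unital (`k`-)algebra `B`. -/
def IsPartialRep {G B : Type*} [Group G] [Monoid B] (π : G → B) : Prop :=
  π 1 = 1 ∧
  (∀ g h : G, π g * π h * π h⁻¹ = π (g * h) * π h⁻¹) ∧
  (∀ g h : G, π g⁻¹ * π g * π h = π g⁻¹ * π (g * h))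

/-- The defining relations of the partial group algebra. -/
inductive ParRel (k G : Type*) [CommSemiring k] [Group G] :
    FreeAlgebra k G → FreeAlgebra k G → Prop
  | one : ParRel k G (FreeAlgebra.ι k (1 : G)) 1
  | pr2 (g h : G) : ParRel k G
      (FreeAlgebra.ι k g * FreeAlgebra.ι k h * FreeAlgebra.ι k h⁻¹)
      (FreeAlgebra.ι k (g * h) * FreeAlgebra.ι k h⁻¹)
  | pr3 (g h : G) : ParRel k G
      (FreeAlgebra.ι k g⁻¹ * FreeAlgebra.ι k g * FreeAlgebra.ι k h)
      (FreeAlgebra.ι k g⁻¹ * FreeAlgebra.ι k (g * h))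

/-- The partial group algebra `k_par G`. -/
abbrev ParAlg (k G : Type*) [CommSemiring k] [Group G] := RingQuot (ParRel k G)

/-- The generator `[g]` of the partial group algebra. -/
noncomputable def parGen (k : Type*) {G : Type*} [CommSemiring k] [Group G] (g : G) :
    ParAlg k G :=
  RingQuot.mkAlgHom k (ParRel k G) (FreeAlgebra.ι k g)

/-- The idempotent `P_X = (∏_{r ∈ X} ε_r)·(∏_{s ∉ X} (1 - ε_s))`, where `ε_g = π(g)π(g⁻¹)`. -/
noncomputable def parP {G B : Type*} [Group G] [Fintype G] [DecidableEq G] [Ring B]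
    (π : G → B) (X : Finset G) : B :=
  (X.toList.map fun r => π r * π r⁻¹).prod *
    (Xᶜ.toList.map fun s => 1 - π s * π s⁻¹).prod

/-- `Γ_X = Σ_{Y ∼ X} P_Y`, where `Y ∼ X` iff `Y = gX` for some `g ∈ G`. -/
noncomputable def parGamma {G B : Type*} [Group G] [Fintype G] [DecidableEq G] [Ring B]
    (π : G → B) (X : Finset G) : B :=
  ∑ Y ∈ Finset.univ.filter (fun Y : Finset G => ∃ g : G, Y = g • X), parP π Y

namespace IsPartialRep

variable {G B : Type*} [Group G]

lemma map_mul_eps [Monoid B] {π : G → B} (hπ : IsPartialRep π) (g h : G) :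
    π g * (π h * π h⁻¹) = π (g * h) * π (g * h)⁻¹ * π g := by
  have h₃ := hπ.2.2 (g * h)⁻¹ g
  rw [inv_inv, show (g * h)⁻¹ * g = h⁻¹ by group] at h₃
  rw [h₃, ← mul_assoc, hπ.2.1]

lemma eps_comm [Monoid B] {π : G → B} (hπ : IsPartialRep π) (g h : G) :
    π g * π g⁻¹ * (π h * π h⁻¹) = π h * π h⁻¹ * (π g * π g⁻¹) := by
  rw [mul_assoc, hπ.map_mul_eps, ← mul_assoc, hπ.map_mul_eps, mul_inv_cancel_left, mul_assoc]

lemma eps_one [Monoid B] {π : G → B} (hπ : IsPartialRep π) : π 1 * π (1 : G)⁻¹ = 1 := by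
  rw [inv_one, hπ.1, one_mul]

end IsPartialRep

lemma Finset.prod_mem_eq_sum_superset {ι A : Type*} [Fintype ι] [DecidableEq ι] [CommRing A]
    (e : ι → A) (s : Finset ι) :
    ∏ i ∈ s, e i =
      ∑ X ∈ Finset.univ.filter (fun X : Finset ι => s ⊆ X),
        (∏ r ∈ X, e r) * ∏ r ∈ Xᶜ, (1 - e r) := by
  have h := Finset.prod_add e (fun i => if i ∈ s then 0 else 1 - e i) Finset.univ
  have hl : ∀ i, e i + (if i ∈ s then 0 else 1 - e i) = if i ∈ s then e i else 1 := by
    intro i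
    split_ifs <;> ring
  simp only [hl, Finset.prod_ite_mem, Finset.univ_inter, Finset.powerset_univ,
    ← Finset.compl_eq_univ_sdiff] at h
  rw [h, Finset.sum_filter]
  refine Finset.sum_congr rfl fun X _ => ?_
  split_ifs with hX
  · congr 1
    refine Finset.prod_congr rfl fun i hi => if_neg fun his => ?_
    exact Finset.mem_compl.1 hi (hX his)
  · obtain ⟨i, his, hi⟩ := Finset.not_subset.1 hX
    refine mul_eq_zero_of_right _ (Finset.prod_eq_zero (Finset.mem_compl.2 hi) ?_)
    exact if_pos his

lemma parP_eq_map {G A B : Type*} [Group G] [Fintype G] [DecidableEq G] [CommRing A] [Ring B]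
    (φ : A →+* B) {π : G → B} {e : G → A} (he : ∀ g, φ (e g) = π g * π g⁻¹) (X : Finset G) :
    parP π X = φ ((∏ r ∈ X, e r) * ∏ r ∈ Xᶜ, (1 - e r)) := by
  rw [← Finset.prod_map_toList, ← Finset.prod_map_toList, map_mul, map_list_prod, map_list_prod,
    List.map_map, List.map_map, parP]
  congr 3 <;> ext r <;> simp [he]

/-- For a finite group `G` and a partial representation `π : G → B`, for every `g ∈ G`
one has `ε_g = Σ_{X ⊆ G, e ∈ X, g ∈ X} P_X`. -/
theorem eps_eq_sum_parP
    (k : Type*) [Field k] {G : Type*} [Group G] [Fintype G] [DecidableEq G]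
    {B : Type*} [Ring B] [Algebra k B]
    (π : G → B) (hπ : IsPartialRep π) (g : G) :
    π g * π g⁻¹ =
      ∑ X ∈ Finset.univ.filter (fun X : Finset G => (1 : G) ∈ X ∧ g ∈ X), parP π X := by
  let S : Set B := Set.range fun h : G => π h * π h⁻¹
  have : IsMulCommutative (Subring.closure S) := Subring.isMulCommutative_closure <| by
    rintro _ ⟨a, rfl⟩ _ ⟨b, rfl⟩
    exact hπ.eps_comm a b
  let _ : CommRing (Subring.closure S) := open scoped IsMulCommutative in inferInstance
  let e : G → Subring.closure S := fun h => ⟨π h * π h⁻¹, Subring.subset_closure ⟨h, rfl⟩⟩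
  let φ : Subring.closure S →+* B := (Subring.closure S).subtype
  have he : ∀ h, φ (e h) = π h * π h⁻¹ := fun _ => rfl
  have e_one : e 1 = 1 := Subtype.ext hπ.eps_one
  have key : e g = ∏ i ∈ ({1, g} : Finset G), e i := by
    by_cases hg : 1 = g
    · simp [← hg]
    · rw [Finset.prod_pair hg, e_one, one_mul]
  rw [← he g, key, Finset.prod_mem_eq_sum_superset, map_sum]
  refine Finset.sum_congr (by simp [Finset.insert_subset_iff]) fun X _ => ?_
  exact (parP_eq_map φ he X).symm
end

section
/- Groupoid multiplication rule: let G be a finite group and π : G → B a partial representation on a unital associative k-algebra B. Then for all g, h ∈ G and all subsets X, Y ⊆ G with e ∈ X and e ∈ Y: (π(g) P_X)·(π(h) P_Y) = π(gh) P_Y if X = hY, and (π(g) P_X)·(π(h) P_Y) = 0 if X ≠ hY. -/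
open scoped Pointwise

theorem List.mul_prod_of_mem_of_mul_eq_self {M : Type*} [Monoid M] {a x : M} {l : List M}
    (hc : ∀ y ∈ l, Commute a y) (hx : x ∈ l) (hax : a * x = x) : a * l.prod = l.prod := by
  induction l with
  | nil => simp at hx
  | cons y l ih =>
    rw [List.prod_cons]
    rcases List.mem_cons.1 hx with rfl | hx
    · rw [← mul_assoc, hax]
    · rw [← mul_assoc, (hc y (by simp)).eq, mul_assoc,
        ih (fun z hz => hc z (List.mem_cons_of_mem _ hz)) hx]

theorem List.mul_prod_of_mem_of_mul_eq_zero {M : Type*} [MonoidWithZero M] {a x : M} {l : List M}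
    (hc : ∀ y ∈ l, Commute a y) (hx : x ∈ l) (hax : a * x = 0) : a * l.prod = 0 := by
  induction l with
  | nil => simp at hx
  | cons y l ih =>
    rw [List.prod_cons]
    rcases List.mem_cons.1 hx with rfl | hx
    · rw [← mul_assoc, hax, zero_mul]
    · rw [← mul_assoc, (hc y (by simp)).eq, mul_assoc,
        ih (fun z hz => hc z (List.mem_cons_of_mem _ hz)) hx, mul_zero]

theorem List.prod_map_mul_eq_ite {α M : Type*} [MonoidWithZero M] (f : α → M) (p : α → Prop)
    [DecidablePred p] (v : M) (hf : ∀ x, f x * v = if p x then v else 0) (l : List α) :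
    (l.map f).prod * v = if ∀ x ∈ l, p x then v else 0 := by
  induction l with
  | nil => simp
  | cons a l ih =>
    rw [List.map_cons, List.prod_cons, mul_assoc, ih]
    simp only [List.forall_mem_cons]
    by_cases hl : ∀ x ∈ l, p x
    · rw [if_pos hl, hf]
      exact if_congr (and_iff_left hl).symm rfl rfl
    · rw [if_neg hl, mul_zero, if_neg fun h => hl h.2]

namespace IsPartialRep

section Monoid

variable {G B : Type*} [Group G] [Monoid B] {π : G → B}

theorem mul_inv_mul_self (hπ : IsPartialRep π) (g : G) : π g * π g⁻¹ * π g = π g := by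
  simpa [hπ.1] using hπ.2.1 g g⁻¹

/-- Translation of `ε_h` past `π g`. -/
theorem mul_eps (hπ : IsPartialRep π) (g h : G) :
    π g * (π h * π h⁻¹) = π (g * h) * π (g * h)⁻¹ * π g := by
  have h3 := hπ.2.2 (g * h)⁻¹ g
  rw [inv_inv, mul_inv_rev, mul_assoc h⁻¹, inv_mul_cancel, mul_one] at h3
  rw [mul_inv_rev, h3, ← mul_assoc, hπ.2.1]

theorem eps_mul (hπ : IsPartialRep π) (g h : G) :
    π g * π g⁻¹ * π h = π h * (π (h⁻¹ * g) * π (h⁻¹ * g)⁻¹) := by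
  rw [hπ.mul_eps, mul_inv_cancel_left]

theorem eps_mul_eps_self (hπ : IsPartialRep π) (g : G) :
    π g * π g⁻¹ * (π g * π g⁻¹) = π g * π g⁻¹ := by
  rw [← mul_assoc, hπ.mul_inv_mul_self]

theorem commute_eps (hπ : IsPartialRep π) (g h : G) :
    Commute (π g * π g⁻¹) (π h * π h⁻¹) := by
  change _ = _
  rw [mul_assoc, hπ.mul_eps g⁻¹ h, ← mul_assoc, hπ.mul_eps g, mul_inv_cancel_left, mul_assoc]

end Monoid

section Ring

variable {G B : Type*} [Group G] [Fintype G] [DecidableEq G] [Ring B] {π : G → B}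

theorem eps_mul_parP (hπ : IsPartialRep π) (X : Finset G) (r : G) :
    π r * π r⁻¹ * parP π X = if r ∈ X then parP π X else 0 := by
  have hc : ∀ y ∈ X.toList.map fun r => π r * π r⁻¹, Commute (π r * π r⁻¹) y := by
    intro y hy
    obtain ⟨s, -, rfl⟩ := List.mem_map.1 hy
    exact hπ.commute_eps r s
  have hc' : ∀ y ∈ Xᶜ.toList.map fun s => 1 - π s * π s⁻¹, Commute (π r * π r⁻¹) y := by
    intro y hy
    obtain ⟨s, -, rfl⟩ := List.mem_map.1 hy
    exact (Commute.one_right _).sub_right (hπ.commute_eps r s)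
  unfold parP
  split_ifs with hr
  · rw [← mul_assoc, List.mul_prod_of_mem_of_mul_eq_self hc
      (List.mem_map.2 ⟨r, Finset.mem_toList.2 hr, rfl⟩) (hπ.eps_mul_eps_self r)]
  · rw [← mul_assoc, (Commute.list_prod_right _ _ hc).eq, mul_assoc,
      List.mul_prod_of_mem_of_mul_eq_zero hc'
        (List.mem_map.2 ⟨r, Finset.mem_toList.2 (Finset.mem_compl.2 hr), rfl⟩), mul_zero]
    rw [mul_sub, mul_one, hπ.eps_mul_eps_self, sub_self]

theorem eps_mul_mul_parP (hπ : IsPartialRep π) (h : G) (Y : Finset G) (r : G) :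
    π r * π r⁻¹ * (π h * parP π Y) = if r ∈ h • Y then π h * parP π Y else 0 := by
  rw [← mul_assoc, hπ.eps_mul, mul_assoc, hπ.eps_mul_parP, mul_ite, mul_zero]
  exact if_congr (by rw [← smul_eq_mul, Finset.inv_smul_mem_iff]) rfl rfl

theorem mul_mul_parP (hπ : IsPartialRep π) (g : G) {h : G} {Y : Finset G} (hY : h⁻¹ ∈ Y) :
    π g * (π h * parP π Y) = π (g * h) * parP π Y := by
  have hP := hπ.eps_mul_parP Y h⁻¹
  rw [if_pos hY] at hP
  rw [← hP]
  simp only [← mul_assoc]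
  rw [hπ.2.1]

end Ring

end IsPartialRep

/-- `P_X` acts as `1` or `0` on simultaneous eigenvectors of the `ε_r`. -/
theorem parP_mul_eq_ite {G B : Type*} [Group G] [Fintype G] [DecidableEq G] [Ring B]
    (π : G → B) (X Z : Finset G) (v : B)
    (hv : ∀ r, π r * π r⁻¹ * v = if r ∈ Z then v else 0) :
    parP π X * v = if X = Z then v else 0 := by
  have hv' : ∀ s, (1 - π s * π s⁻¹) * v = if s ∉ Z then v else 0 := by
    intro s
    rw [sub_mul, one_mul, hv]
    split_ifs <;> simp_all
  rw [parP, mul_assoc, List.prod_map_mul_eq_ite _ (· ∉ Z) v hv', mul_ite, mul_zero,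
    List.prod_map_mul_eq_ite _ (· ∈ Z) v hv, ← ite_and]
  simp only [Finset.mem_toList, Finset.mem_compl]
  congr 1
  apply propext
  constructor
  · rintro ⟨h₁, h₂⟩
    ext r
    exact ⟨h₂ r, fun hr => by_contra fun hX => h₁ r hX hr⟩
  · rintro rfl
    exact ⟨fun _ h => h, fun _ h => h⟩

/-- **Groupoid multiplication rule.** For a finite group `G`, a partial representation
`π : G → B`, `g, h ∈ G` and subsets `X, Y ⊆ G` containing `e`:
`(π(g) P_X)(π(h) P_Y) = π(gh) P_Y` if `X = hY`, and `= 0` otherwise. -/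
theorem parP_groupoid_mul
    (k : Type*) [Field k] {G : Type*} [Group G] [Fintype G] [DecidableEq G]
    {B : Type*} [Ring B] [Algebra k B]
    (π : G → B) (hπ : IsPartialRep π) (g h : G) (X Y : Finset G)
    (hX : (1 : G) ∈ X) (hY : (1 : G) ∈ Y) :
    (π g * parP π X) * (π h * parP π Y) =
      if X = h • Y then π (g * h) * parP π Y else 0 := by
  rw [mul_assoc, parP_mul_eq_ite π X (h • Y) _ (hπ.eps_mul_mul_parP h Y), mul_ite, mul_zero]
  split_ifs with hXY
  · refine hπ.mul_mul_parP g ?_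
    rw [hXY, ← Finset.inv_smul_mem_iff] at hX
    simpa using hX
  · rfl
end

section
/- Matryoshka's Theorem (non-monoidal part): let k be an algebraically closed field of characteristic zero, G a finite abelian group, and H ≤ G a subgroup. Then there exists a k-linear functor F from the category of left modules over the partial group algebra k_par H to the category of left modules over the partial group algebra k_par G such that: (1) F is additive; (2) F is faithful; (3) F is injective on objects; (4) F sends simple k_par H-modules to simple k_par G-modules. -/
open scoped Pointwise

universe u

universe w

open CategoryTheory

/-- Extending a partial representation of a subgroup by zero yields a surjective algebra
homomorphism of partial group algebras. -/
theorem ParAlg.exists_surjective_algHom (k : Type*) {G : Type*} [CommSemiring k] [Group G]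
    (H : Subgroup G) : ∃ φ : ParAlg k G →ₐ[k] ParAlg k ↥H, Function.Surjective φ := by
  classical
  let π : G → ParAlg k ↥H := fun g => if hg : g ∈ H then parGen k (⟨g, hg⟩ : H) else 0
  have π_mem (g : H) : π g = parGen k g := dif_pos g.2
  have π_notMem {g : G} (hg : g ∉ H) : π g = 0 := dif_neg hg
  have gen_one : parGen k (1 : H) = 1 := by
    simpa [parGen] using RingQuot.mkAlgHom_rel k (ParRel.one (k := k) (G := H))
  have gen_mul (g h : H) :
      parGen k g * parGen k h * parGen k h⁻¹ = parGen k (g * h) * parGen k h⁻¹ := by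
    simpa [parGen] using RingQuot.mkAlgHom_rel k (ParRel.pr2 (k := k) g h)
  have gen_mul' (g h : H) :
      parGen k g⁻¹ * parGen k g * parGen k h = parGen k g⁻¹ * parGen k (g * h) := by
    simpa [parGen] using RingQuot.mkAlgHom_rel k (ParRel.pr3 (k := k) g h)
  have hπ ⦃x y : FreeAlgebra k G⦄ (hxy : ParRel k G x y) :
      FreeAlgebra.lift k π x = FreeAlgebra.lift k π y := by
    induction hxy with
    | one => simpa [gen_one] using π_mem 1
    | pr2 g h =>
      simp only [map_mul, FreeAlgebra.lift_ι_apply]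
      by_cases hh : h ∈ H
      · by_cases hg : g ∈ H
        · simpa only [← π_mem, Subgroup.coe_mul, Subgroup.coe_inv] using gen_mul ⟨g, hg⟩ ⟨h, hh⟩
        · rw [π_notMem hg, π_notMem (g := g * h) (by rwa [H.mul_mem_cancel_right hh])]
          simp
      · rw [π_notMem hh, π_notMem (g := h⁻¹) (by rwa [H.inv_mem_iff])]
        simp
    | pr3 g h =>
      simp only [map_mul, FreeAlgebra.lift_ι_apply]
      by_cases hg : g ∈ H
      · by_cases hh : h ∈ H
        · simpa only [← π_mem, Subgroup.coe_mul, Subgroup.coe_inv] using gen_mul' ⟨g, hg⟩ ⟨h, hh⟩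
        · rw [π_notMem hh, π_notMem (g := g * h) (by rwa [H.mul_mem_cancel_left hg])]
          simp
      · rw [π_notMem hg, π_notMem (g := g⁻¹) (by rwa [H.inv_mem_iff])]
        simp
  let φ : ParAlg k G →ₐ[k] ParAlg k ↥H := RingQuot.liftAlgHom k ⟨FreeAlgebra.lift k π, hπ⟩
  have φ_gen (g : H) : φ (parGen k (g : G)) = parGen k g := by
    simp [φ, parGen, RingQuot.liftAlgHom_mkAlgHom_apply, π_mem]
  refine ⟨φ, fun y => ?_⟩
  obtain ⟨x, rfl⟩ := RingQuot.mkAlgHom_surjective k (ParRel k H) y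
  induction x using FreeAlgebra.induction with
  | grade0 r => exact ⟨algebraMap k _ r, by simp⟩
  | grade1 g => exact ⟨parGen k (g : G), φ_gen g⟩
  | mul a b ha hb =>
    obtain ⟨a', ha⟩ := ha
    obtain ⟨b', hb⟩ := hb
    exact ⟨a' * b', by simp [ha, hb]⟩
  | add a b ha hb =>
    obtain ⟨a', ha⟩ := ha
    obtain ⟨b', hb⟩ := hb
    exact ⟨a' + b', by simp [ha, hb]⟩

/-- Restriction of scalars along a surjective ring homomorphism is injective on objects. -/
theorem ModuleCat.restrictScalars_obj_injective {R S : Type*} [Ring R] [Ring S] (f : R →+* S)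
    (hf : Function.Surjective f) :
    Function.Injective (ModuleCat.restrictScalars.{w} f).obj := by
  intro M N h
  obtain ⟨M, instM⟩ := M
  obtain ⟨N, instN⟩ := N
  injection h with hMN hgrp hmod
  obtain rfl : M = N := hMN
  obtain rfl := eq_of_heq hgrp
  congr 1
  apply Module.ext'
  intro s m
  obtain ⟨r, rfl⟩ := hf s
  exact congrArg (fun inst : Module R M => inst.smul r m) (eq_of_heq hmod)

/-- Restriction of scalars along a surjective ring homomorphism preserves simple modules. -/
theorem ModuleCat.isSimpleModule_restrictScalars_obj {R S : Type*} [Ring R] [Ring S] (f : R →+* S)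
    (hf : Function.Surjective f) (M : ModuleCat.{w} S) (hM : IsSimpleModule S M) :
    IsSimpleModule R ((ModuleCat.restrictScalars f).obj M) := by
  have : RingHomSurjective f := ⟨hf⟩
  let e : (ModuleCat.restrictScalars f).obj M →ₛₗ[f] M :=
    { toFun := fun m => m
      map_add' := fun _ _ => rfl
      map_smul' := fun _ _ => rfl }
  exact (LinearMap.isSimpleModule_iff_of_bijective e Function.bijective_id).mpr hM

/-- **Matryoshka's Theorem (non-monoidal part).** Let `k` be an algebraically closed
field of characteristic zero, `G` a finite abelian group, and `H ≤ G` a subgroup.  Then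
there exists a `k`-linear functor `F` from left `k_par H`-modules to left
`k_par G`-modules which is additive, faithful, injective on objects, and sends simple
`k_par H`-modules to simple `k_par G`-modules. -/
theorem matryoshka
    (k : Type u) [Field k] [IsAlgClosed k] [CharZero k]
    (G : Type u) [CommGroup G] [Fintype G] (H : Subgroup G) :
    ∃ F : ModuleCat.{u} (ParAlg k ↥H) ⥤ ModuleCat.{u} (ParAlg k G),
      F.Additive ∧
      F.Faithful ∧
      Function.Injective F.obj ∧
      (∀ (V W : ModuleCat.{u} (ParAlg k ↥H)) (f : V ⟶ W) (c : k),
        F.map (c • f) = c • F.map f) ∧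
      (∀ V : ModuleCat.{u} (ParAlg k ↥H),
        IsSimpleModule (ParAlg k ↥H) V → IsSimpleModule (ParAlg k G) (F.obj V)) := by
  obtain ⟨φ, hφ⟩ := ParAlg.exists_surjective_algHom k H
  refine ⟨ModuleCat.restrictScalars φ.toRingHom, inferInstance, inferInstance,
    ModuleCat.restrictScalars_obj_injective _ hφ, fun V W f c => ?_,
    ModuleCat.isSimpleModule_restrictScalars_obj _ hφ⟩
  ext v
  change algebraMap k (ParAlg k ↥H) c • f v = φ (algebraMap k (ParAlg k G) c) • f v
  rw [φ.commutes]
end
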